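/- Let $f\in L_p(\mathbb{T})$, $1\le p<\infty$, $r,n\in\mathbb{N}$, and suppose the sampling operators $G_n$ satisfy conditions (c1) and (c2') for some $s\in\mathbb{N}$ with $s\le 2r$. Then there exists a constant $C_1>0$ independent of $f$ and $n$ such that $\|f-G_n(f)\|_p\le K_1\|f_{\gamma/n,\,r}-f\|_{\ell_p(X_n)}+C_1\,\omega_s(f,1/n)_p$. -/

import Mathlib

open MeasureTheory Filter Finset

noncomputable def LpNorm (p : ℝ) (f : ℝ → ℝ) : ℝ :=
  (∫ x in (0:ℝ)..1, |f x| ^ p) ^ (1 / p)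

def MemLpT (p : ℝ) (f : ℝ → ℝ) : Prop :=
  Function.Periodic f 1 ∧ Measurable f ∧
    IntervalIntegrable (fun x => |f x| ^ p) MeasureTheory.volume 0 1

noncomputable def Delta (r : ℕ) (h : ℝ) (f : ℝ → ℝ) (x : ℝ) : ℝ :=
  ∑ ν ∈ Finset.range (r + 1), ((-1 : ℝ) ^ ν * (r.choose ν : ℝ)) * f (x + ((r : ℝ) - (ν : ℝ)) * h)

noncomputable def omegaMod (r : ℕ) (p : ℝ) (f : ℝ → ℝ) (δ : ℝ) : ℝ :=
  sSup {y | ∃ h : ℝ, 0 < h ∧ h < δ ∧ y = LpNorm p (Delta r h f)}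

noncomputable def steklov (r : ℕ) (δ : ℝ) (f : ℝ → ℝ) (x : ℝ) : ℝ :=
  (-1 : ℝ) ^ (r + 1) * (((2 * r).choose r : ℝ))⁻¹ * (2 / δ) *
    ∫ t in (-(δ / 2))..(δ / 2),
      ∑ ν ∈ Finset.range r,
        (-1 : ℝ) ^ ν * (((2 * r).choose ν : ℝ)) * f (x + (((r : ℝ) - (ν : ℝ)) / (r : ℝ)) * t)

noncomputable def ellp (p : ℝ) (n : ℕ) (x : ℕ → ℝ) (f : ℝ → ℝ) : ℝ :=
  ((1 / (n : ℝ)) * ∑ k ∈ Finset.range n, |f (x k)| ^ p) ^ (1 / p)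

def SobolevW (s : ℕ) (g : ℝ → ℝ) : Prop :=
  Function.Periodic g 1 ∧ ContDiff ℝ (s : ℕ∞) g

noncomputable def localMod (r : ℕ) (f : ℝ → ℝ) (x δ : ℝ) : ℝ :=
  sSup {y | ∃ t h : ℝ, t ∈ Set.Icc (x - r * δ / 2) (x + r * δ / 2) ∧
    (t + r * h) ∈ Set.Icc (x - r * δ / 2) (x + r * δ / 2) ∧ y = |Delta r h f t|}

noncomputable def tauMod (r : ℕ) (p : ℝ) (f : ℝ → ℝ) (δ : ℝ) : ℝ :=
  (∫ x in (0:ℝ)..1, localMod r f x δ ^ p) ^ (1 / p)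

def IsTrigPoly (n : ℕ) (T : ℝ → ℝ) : Prop :=
  ∃ c : ℤ → ℂ, ∀ x : ℝ, (T x : ℂ) =
    ∑ ℓ ∈ Finset.Icc (-(n : ℤ)) (n : ℤ),
      c ℓ * Complex.exp (2 * Real.pi * Complex.I * (ℓ : ℂ) * (x : ℂ))

noncomputable def tildeE (n : ℕ) (p : ℝ) (f : ℝ → ℝ) : ℝ :=
  sInf {y | ∃ Q q : ℝ → ℝ, IsTrigPoly n Q ∧ IsTrigPoly n q ∧
    (∀ x, q x ≤ f x ∧ f x ≤ Q x) ∧ y = LpNorm p (fun x => Q x - q x)}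

noncomputable def dirichlet (n : ℕ) (x : ℝ) : ℝ :=
  ∑ ℓ ∈ Finset.Icc (-(n : ℤ)) (n : ℤ), Real.cos (2 * Real.pi * (ℓ : ℝ) * x)

noncomputable def lagrange (n : ℕ) (f : ℝ → ℝ) (x : ℝ) : ℝ :=
  (1 / (2 * (n : ℝ) + 1)) * ∑ k ∈ Finset.range (2 * n + 1),
    f ((k : ℝ) / (2 * (n : ℝ) + 1)) * dirichlet n (x - (k : ℝ) / (2 * (n : ℝ) + 1))

def NodesOK (γ : ℝ) (X : ℕ → ℕ → ℝ) : Prop :=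
  ∀ n : ℕ, 1 ≤ n →
    (0 ≤ X n 0) ∧ (∀ k, k + 1 < n → X n k < X n (k + 1)) ∧ (X n (n - 1) < 1) ∧
    (∀ k, k + 1 < n → γ / (n : ℝ) ≤ X n (k + 1) - X n k) ∧
    (γ / (n : ℝ) ≤ 1 + X n 0 - X n (n - 1))

def NodesOrd (X : ℕ → ℕ → ℝ) : Prop :=
  ∀ n : ℕ, 1 ≤ n →
    (0 ≤ X n 0) ∧ (∀ k, k + 1 < n → X n k < X n (k + 1)) ∧ (X n (n - 1) < 1)

def SamplingForm (p : ℝ) (X : ℕ → ℕ → ℝ) (φ : ℕ → ℕ → ℝ → ℝ)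
    (G : ℕ → (ℝ → ℝ) → ℝ → ℝ) : Prop :=
  (∀ n k, MemLpT p (φ n k)) ∧
  ∀ (n : ℕ) (f : ℝ → ℝ) (x : ℝ), G n f x = ∑ k ∈ Finset.range n, f (X n k) * φ n k x

def CondC1 (p K1 : ℝ) (X : ℕ → ℕ → ℝ) (G : ℕ → (ℝ → ℝ) → ℝ → ℝ) : Prop :=
  ∀ f : ℝ → ℝ, MemLpT p f → ∀ n : ℕ, 1 ≤ n → LpNorm p (G n f) ≤ K1 * ellp p n (X n) f

def CondC1' (p K2 : ℝ) (X : ℕ → ℕ → ℝ) (G : ℕ → (ℝ → ℝ) → ℝ → ℝ) : Prop :=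
  ∀ f : ℝ → ℝ, MemLpT p f → ∀ n : ℕ, 1 ≤ n → K2 * ellp p n (X n) f ≤ LpNorm p (G n f)

def CondC2' (p K3 : ℝ) (s : ℕ) (G : ℕ → (ℝ → ℝ) → ℝ → ℝ) : Prop :=
  ∀ g : ℝ → ℝ, SobolevW s g → ∀ n : ℕ, 1 ≤ n →
    LpNorm p (fun x => g x - G n g x) ≤ K3 / (n : ℝ) ^ s * LpNorm p (iteratedDeriv s g)

def CondC3 (p K5 : ℝ) (s : ℕ) (G : ℕ → (ℝ → ℝ) → ℝ → ℝ) : Prop :=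
  ∀ f : ℝ → ℝ, MemLpT p f → ∀ n : ℕ, 1 ≤ n →
    SobolevW s (G n f) ∧
    (1 / (n : ℝ) ^ s) * LpNorm p (iteratedDeriv s (G n f)) ≤
      K5 * omegaMod s p (G n f) (1 / (n : ℝ))

noncomputable def Gprev (G : ℕ → (ℝ → ℝ) → ℝ → ℝ) (f : ℝ → ℝ) (ν : ℕ) : ℝ → ℝ :=
  if ν = 0 then fun _ => 0 else G (2 ^ (ν - 1)) f

def CondC4 (p K4 : ℝ) (s : ℕ) (G : ℕ → (ℝ → ℝ) → ℝ → ℝ) (f : ℝ → ℝ) : Prop :=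
  ∀ ν : ℕ,
    SobolevW s (fun x => G (2 ^ ν) f x - Gprev G f ν x) ∧
    LpNorm p (iteratedDeriv s (fun x => G (2 ^ ν) f x - Gprev G f ν x)) ≤
      K4 * 2 ^ (s * ν) * LpNorm p (fun x => G (2 ^ ν) f x - Gprev G f ν x)

noncomputable def Kfun (s : ℕ) (p : ℝ) (n : ℕ) (x : ℕ → ℝ) (f : ℝ → ℝ) : ℝ :=
  sInf {y | ∃ g : ℝ → ℝ, SobolevW s g ∧
    y = ellp p n x (fun t => f t - g t) + LpNorm p (fun t => f t - g t) +
        (1 / (n : ℝ) ^ s) * LpNorm p (iteratedDeriv s g)}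


/-! ### Basic facts on the norm -/

noncomputable def EN (p : ℝ) (f : ℝ → ℝ) : ENNReal :=
  eLpNorm' f p (volume.restrict (Set.Ioc (0:ℝ) 1))

lemma enorm_rpow_eq (p : ℝ) (hp : 0 ≤ p) (y : ℝ) : ‖y‖ₑ ^ p = ENNReal.ofReal (|y| ^ p) := by
  rw [← ENNReal.ofReal_rpow_of_nonneg (abs_nonneg y) hp, Real.enorm_eq_ofReal_abs]

lemma LpNorm_eq (p : ℝ) (hp : 1 ≤ p) (f : ℝ → ℝ) (hf : Measurable f) :
    LpNorm p f = (EN p f).toReal := by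
  unfold LpNorm EN eLpNorm'
  rw [intervalIntegral.integral_of_le zero_le_one, integral_eq_lintegral_of_nonneg_ae,
    ENNReal.toReal_rpow]
  · simp_rw [enorm_rpow_eq p (by linarith)]
  · exact Eventually.of_forall fun x => Real.rpow_nonneg (abs_nonneg _) _
  · exact (((continuous_abs.measurable.comp hf).pow_const p).aestronglyMeasurable)

lemma memLpT_iff (p : ℝ) (hp : 1 ≤ p) (f : ℝ → ℝ) :
    MemLpT p f ↔ Function.Periodic f 1 ∧ Measurable f ∧ EN p f ≠ ⊤ := by
  unfold MemLpT
  refine and_congr_right fun _ => and_congr_right fun hf => ?_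
  rw [intervalIntegrable_iff_integrableOn_Ioc_of_le zero_le_one]
  have hm : AEStronglyMeasurable (fun x => |f x| ^ p) (volume.restrict (Set.Ioc (0:ℝ) 1)) :=
    (((continuous_abs.measurable.comp hf).pow_const p).aestronglyMeasurable)
  unfold IntegrableOn Integrable HasFiniteIntegral EN eLpNorm'
  have : ∀ x, ‖|f x| ^ p‖ₑ = ‖f x‖ₑ ^ p := fun x => by
    rw [enorm_rpow_eq p (by linarith), Real.enorm_eq_ofReal (Real.rpow_nonneg (abs_nonneg _) _)]
  simp_rw [this]
  rw [ne_eq, ENNReal.rpow_eq_top_iff_of_pos (by positivity), ← ne_eq, ← lt_top_iff_ne_top]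
  tauto

lemma ofReal_LpNorm (p : ℝ) (hp : 1 ≤ p) (f : ℝ → ℝ) (hf : MemLpT p f) :
    ENNReal.ofReal (LpNorm p f) = EN p f := by
  have h := (memLpT_iff p hp f).1 hf
  rw [LpNorm_eq p hp f hf.2.1, ENNReal.ofReal_toReal h.2.2]

lemma LpNorm_nonneg (p : ℝ) (f : ℝ → ℝ) : 0 ≤ LpNorm p f := by
  unfold LpNorm
  apply Real.rpow_nonneg
  apply intervalIntegral.integral_nonneg zero_le_one
  intro x _
  positivity

lemma EN_add_le (p : ℝ) (hp : 1 ≤ p) (f g : ℝ → ℝ) (hf : Measurable f) (hg : Measurable g) :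
    EN p (fun x => f x + g x) ≤ EN p f + EN p g :=
  eLpNorm'_add_le hf.aestronglyMeasurable hg.aestronglyMeasurable hp

lemma EN_const_mul (p : ℝ) (hp : 1 ≤ p) (c : ℝ) (f : ℝ → ℝ) :
    EN p (fun x => c * f x) = ‖c‖ₑ * EN p f :=
  eLpNorm'_const_smul (f := f) c (by linarith)

lemma MemLpT.add {p : ℝ} (hp : 1 ≤ p) {f g : ℝ → ℝ} (hf : MemLpT p f) (hg : MemLpT p g) :
    MemLpT p (fun x => f x + g x) := by
  rw [memLpT_iff p hp] at *
  exact ⟨fun x => by simp [hf.1 x, hg.1 x], hf.2.1.add hg.2.1,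
    ne_top_of_le_ne_top (ENNReal.add_ne_top.2 ⟨hf.2.2, hg.2.2⟩)
      (EN_add_le p hp f g hf.2.1 hg.2.1)⟩

lemma MemLpT.const_mul {p : ℝ} (hp : 1 ≤ p) {f : ℝ → ℝ} (hf : MemLpT p f) (c : ℝ) :
    MemLpT p (fun x => c * f x) := by
  rw [memLpT_iff p hp] at *
  refine ⟨fun x => by simp [hf.1 x], hf.2.1.const_mul c, ?_⟩
  rw [EN_const_mul p hp]
  exact ENNReal.mul_ne_top (by simp) hf.2.2

lemma MemLpT.sub {p : ℝ} (hp : 1 ≤ p) {f g : ℝ → ℝ} (hf : MemLpT p f) (hg : MemLpT p g) :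
    MemLpT p (fun x => f x - g x) := by
  have := hf.add hp (hg.const_mul hp (-1))
  simpa [sub_eq_add_neg] using this

lemma memLpT_zero {p : ℝ} (hp : 1 ≤ p) : MemLpT p (fun _ => 0) := by
  refine ⟨fun x => rfl, measurable_const, ?_⟩
  simp

lemma MemLpT.sum {p : ℝ} (hp : 1 ≤ p) {ι : Type*} (S : Finset ι) (f : ι → ℝ → ℝ)
    (hf : ∀ i ∈ S, MemLpT p (f i)) : MemLpT p (fun x => ∑ i ∈ S, f i x) := by
  classical
  induction S using Finset.induction_on with
  | empty => simpa using memLpT_zero hp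
  | insert a S ha ih =>
    simp_rw [Finset.sum_insert ha]
    exact (hf a (by simp)).add hp (ih fun i hi => hf i (by simp [hi]))

lemma MemLpT.shift {p : ℝ} (hp : 1 ≤ p) {f : ℝ → ℝ} (hf : MemLpT p f) (u : ℝ) :
    MemLpT p (fun x => f (x + u)) := by
  refine ⟨fun x => ?_, hf.2.1.comp (measurable_id.add_const u), ?_⟩
  · show f (x + 1 + u) = f (x + u)
    rw [add_right_comm, hf.1]
  · have hper : Function.Periodic (fun x => |f x| ^ p) 1 := fun x => by simp [hf.1 x]
    have h := hper.intervalIntegrable (t := 0) one_ne_zero (by simpa using hf.2.2) (0 + u) (1 + u)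
    simpa using h.comp_add_right u

lemma LpNorm_shift (p : ℝ) {f : ℝ → ℝ} (hf : Function.Periodic f 1) (u : ℝ) :
    LpNorm p (fun x => f (x + u)) = LpNorm p f := by
  unfold LpNorm
  have hper : Function.Periodic (fun x => |f x| ^ p) 1 := fun x => by simp [hf x]
  have h := hper.intervalIntegral_add_eq u 0
  rw [intervalIntegral.integral_comp_add_right (fun x => |f x| ^ p) u]
  rw [zero_add, add_comm 1 u, h, zero_add]

lemma LpNorm_add_le {p : ℝ} (hp : 1 ≤ p) {f g : ℝ → ℝ} (hf : MemLpT p f) (hg : MemLpT p g) :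
    LpNorm p (fun x => f x + g x) ≤ LpNorm p f + LpNorm p g := by
  have h := EN_add_le p hp f g hf.2.1 hg.2.1
  rw [← ofReal_LpNorm p hp _ hf, ← ofReal_LpNorm p hp _ hg, ← ofReal_LpNorm p hp _ (hf.add hp hg),
    ← ENNReal.ofReal_add (LpNorm_nonneg _ _) (LpNorm_nonneg _ _)] at h
  exact (ENNReal.ofReal_le_ofReal_iff (add_nonneg (LpNorm_nonneg _ _) (LpNorm_nonneg _ _))).1 h

lemma LpNorm_const_mul {p : ℝ} (hp : 1 ≤ p) {f : ℝ → ℝ} (hf : MemLpT p f) (c : ℝ) :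
    LpNorm p (fun x => c * f x) = |c| * LpNorm p f := by
  rw [LpNorm_eq p hp _ (hf.2.1.const_mul c), EN_const_mul p hp, LpNorm_eq p hp _ hf.2.1]
  simp

lemma LpNorm_zero {p : ℝ} (hp : 1 ≤ p) : LpNorm p (fun _ => 0) = 0 := by
  have h := LpNorm_const_mul hp (memLpT_zero hp) 0
  simpa using h

lemma LpNorm_sub_le {p : ℝ} (hp : 1 ≤ p) {f g : ℝ → ℝ} (hf : MemLpT p f) (hg : MemLpT p g) :
    LpNorm p (fun x => f x - g x) ≤ LpNorm p f + LpNorm p g := by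
  have := LpNorm_add_le hp hf (hg.const_mul hp (-1))
  rw [LpNorm_const_mul hp hg] at this
  simpa [sub_eq_add_neg] using this

lemma LpNorm_sum_le {p : ℝ} (hp : 1 ≤ p) {ι : Type*} (S : Finset ι) (f : ι → ℝ → ℝ)
    (hf : ∀ i ∈ S, MemLpT p (f i)) :
    LpNorm p (fun x => ∑ i ∈ S, f i x) ≤ ∑ i ∈ S, LpNorm p (f i) := by
  classical
  induction S using Finset.induction_on with
  | empty => simpa using (LpNorm_zero hp).le
  | insert a S ha ih =>
    simp_rw [Finset.sum_insert ha]
    refine (LpNorm_add_le hp (hf a (by simp))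
      (MemLpT.sum hp S f fun i hi => hf i (by simp [hi]))).trans ?_
    gcongr
    exact ih fun i hi => hf i (by simp [hi])

lemma MemLpT.abs {p : ℝ} {f : ℝ → ℝ} (hf : MemLpT p f) : MemLpT p (fun x => |f x|) := by
  refine ⟨fun x => by simp [hf.1 x], continuous_abs.measurable.comp hf.2.1, ?_⟩
  simpa using hf.2.2

lemma LpNorm_abs (p : ℝ) (f : ℝ → ℝ) : LpNorm p (fun x => |f x|) = LpNorm p f := by
  simp [LpNorm]

lemma memLpT_of_continuous {p : ℝ} (hp : 1 ≤ p) {f : ℝ → ℝ} (hf : Continuous f)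
    (hper : Function.Periodic f 1) : MemLpT p f := by
  refine ⟨hper, hf.measurable, ?_⟩
  apply Continuous.intervalIntegrable
  exact hf.abs.rpow_const fun x => Or.inr (by linarith)

/-- functions in the class are integrable on every interval -/
lemma MemLpT.intervalIntegrable {p : ℝ} (hp : 1 ≤ p) {f : ℝ → ℝ} (hf : MemLpT p f) (a b : ℝ) :
    IntervalIntegrable f volume a b := by
  apply hf.1.intervalIntegrable (t := 0) one_ne_zero
  rw [zero_add, intervalIntegrable_iff_integrableOn_Ioc_of_le zero_le_one]
  have : IsProbabilityMeasure (volume.restrict (Set.Ioc (0:ℝ) 1)) := ⟨by simp⟩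
  refine ⟨hf.2.1.aestronglyMeasurable, ?_⟩
  have h := eLpNorm'_le_eLpNorm'_of_exponent_le (p := 1) (q := p) one_pos hp
    (volume.restrict (Set.Ioc (0:ℝ) 1)) hf.2.1.aestronglyMeasurable
  have h2 := ((memLpT_iff p hp f).1 hf).2.2
  unfold HasFiniteIntegral
  have h3 := h.trans_lt (lt_top_iff_ne_top.2 h2)
  simpa [eLpNorm'] using h3

lemma MemLpT.comp_affine_intervalIntegrable {p : ℝ} (hp : 1 ≤ p) {f : ℝ → ℝ} (hf : MemLpT p f)
    (x c a b : ℝ) : IntervalIntegrable (fun t => f (x + c * t)) volume a b := by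
  by_cases hc : c = 0
  · simp [hc]
  · have h1 := (hf.shift hp x).intervalIntegrable hp (c * a) (c * b)
    have h := h1.comp_mul_left (c := c)
    rw [mul_div_cancel_left₀ _ hc, mul_div_cancel_left₀ _ hc] at h
    simpa [add_comm] using h

/-- The Minkowski integral inequality in the form we need. -/
lemma minkowski {p : ℝ} (hp : 1 ≤ p) (F : ℝ → ℝ → ℝ) (hF : Measurable (Function.uncurry F))
    (hmem : ∀ t ∈ Set.Icc (0:ℝ) 1, MemLpT p (fun x => F x t)) (M : ℝ) (hM : 0 ≤ M)
    (hle : ∀ t ∈ Set.Icc (0:ℝ) 1, LpNorm p (fun x => F x t) ≤ M) :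
    MemLpT p (fun x => ∫ t in (0:ℝ)..1, F x t) ∧
      LpNorm p (fun x => ∫ t in (0:ℝ)..1, F x t) ≤ M := by
  have hp0 : 0 < p := by linarith
  have : IsProbabilityMeasure (volume.restrict (Set.Ioc (0:ℝ) 1)) := ⟨by simp⟩
  have hmeas : Measurable (fun x => ∫ t in (0:ℝ)..1, F x t) := by
    simp_rw [intervalIntegral.integral_of_le zero_le_one]
    exact (StronglyMeasurable.integral_prod_right hF.stronglyMeasurable).measurable
  have key : EN p (fun x => ∫ t in (0:ℝ)..1, F x t) ≤ ENNReal.ofReal M := by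
    unfold EN eLpNorm'
    rw [one_div, ENNReal.rpow_inv_le_iff hp0]
    have h1 : ∀ x, ‖∫ t in (0:ℝ)..1, F x t‖ₑ ^ p ≤
        ∫⁻ t in Set.Ioc (0:ℝ) 1, ‖F x t‖ₑ ^ p := by
      intro x
      rw [intervalIntegral.integral_of_le zero_le_one]
      have hx : Measurable (F x) := hF.comp (measurable_prodMk_left)
      have h := eLpNorm'_le_eLpNorm'_of_exponent_le (p := 1) (q := p) one_pos hp
        (volume.restrict (Set.Ioc (0:ℝ) 1)) hx.aestronglyMeasurable
      have h2 := (enorm_integral_le_lintegral_enorm (μ := volume.restrict (Set.Ioc (0:ℝ) 1))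
        (F x)).trans (le_trans (by simp [eLpNorm']) h)
      unfold eLpNorm' at h2
      rwa [one_div, ENNReal.le_rpow_inv_iff hp0] at h2
    calc _ ≤ ∫⁻ x in Set.Ioc (0:ℝ) 1, ∫⁻ t in Set.Ioc (0:ℝ) 1, ‖F x t‖ₑ ^ p :=
          lintegral_mono h1
      _ = ∫⁻ t in Set.Ioc (0:ℝ) 1, ∫⁻ x in Set.Ioc (0:ℝ) 1, ‖F x t‖ₑ ^ p := by
          apply lintegral_lintegral_swap
          exact (hF.enorm.pow_const p).aemeasurable
      _ ≤ ∫⁻ t in Set.Ioc (0:ℝ) 1, ENNReal.ofReal M ^ p := by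
          apply setLIntegral_mono' measurableSet_Ioc
          intro t ht
          have ht' : t ∈ Set.Icc (0:ℝ) 1 := ⟨ht.1.le, ht.2⟩
          have h := ENNReal.ofReal_le_ofReal (hle t ht')
          rw [ofReal_LpNorm p hp _ (hmem t ht')] at h
          unfold EN eLpNorm' at h
          rwa [one_div, ENNReal.rpow_inv_le_iff hp0] at h
      _ = ENNReal.ofReal M ^ p := by simp
  have hper : Function.Periodic (fun x => ∫ t in (0:ℝ)..1, F x t) 1 := by
    intro x
    apply intervalIntegral.integral_congr
    intro t ht
    rw [Set.uIcc_of_le zero_le_one] at ht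
    exact (hmem t ht).1 x
  refine ⟨(memLpT_iff p hp _).2 ⟨hper, hmeas, ne_top_of_le_ne_top ENNReal.ofReal_ne_top key⟩, ?_⟩
  rw [LpNorm_eq p hp _ hmeas]
  exact ENNReal.toReal_le_of_le_ofReal hM key

/-! ### Averages -/

noncomputable def Av (c : ℝ) (F : ℝ → ℝ) (x : ℝ) : ℝ := ∫ t in (0:ℝ)..1, F (x + c * t)

lemma Av_mem {p : ℝ} (hp : 1 ≤ p) {F : ℝ → ℝ} (hF : MemLpT p F) (c : ℝ) :
    MemLpT p (Av c F) ∧ LpNorm p (Av c F) ≤ LpNorm p F := by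
  apply minkowski hp (fun x t => F (x + c * t))
  · exact hF.2.1.comp (by fun_prop)
  · exact fun t _ => hF.shift hp (c * t)
  · exact LpNorm_nonneg _ _
  · exact fun t _ => (LpNorm_shift p hF.1 (c * t)).le

lemma Av_zero (F : ℝ → ℝ) : Av 0 F = F := by
  ext x
  simp [Av]

lemma Av_eq {p : ℝ} (hp : 1 ≤ p) {F : ℝ → ℝ} (hF : MemLpT p F) {c : ℝ} (hc : c ≠ 0) (x : ℝ) :
    Av c F x = c⁻¹ * ((∫ t in (0:ℝ)..(x + c), F t) - ∫ t in (0:ℝ)..x, F t) := by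
  unfold Av
  rw [intervalIntegral.integral_comp_add_mul F hc x, smul_eq_mul,
    intervalIntegral.integral_interval_sub_left (hF.intervalIntegrable hp _ _)
      (hF.intervalIntegrable hp _ _)]
  simp

lemma Av_continuous {p : ℝ} (hp : 1 ≤ p) {F : ℝ → ℝ} (hF : MemLpT p F) {c : ℝ} (hc : c ≠ 0) :
    Continuous (Av c F) := by
  have h : Continuous (fun x => ∫ t in (0:ℝ)..x, F t) :=
    intervalIntegral.continuous_primitive (fun a b => hF.intervalIntegrable hp a b) 0
  rw [funext (Av_eq hp hF hc)]
  exact continuous_const.mul ((h.comp (continuous_add_const c)).sub h)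

lemma Av_hasDerivAt {p : ℝ} (hp : 1 ≤ p) {F : ℝ → ℝ} (hF : MemLpT p F) (hcont : Continuous F)
    {c : ℝ} (hc : c ≠ 0) (x : ℝ) : HasDerivAt (Av c F) (c⁻¹ * fwdDiff c F x) x := by
  have h : ∀ y, HasDerivAt (fun x => ∫ t in (0:ℝ)..x, F t) (F y) y := fun y =>
    intervalIntegral.integral_hasDerivAt_right (hcont.intervalIntegrable _ _)
      (hcont.stronglyMeasurableAtFilter _ _) hcont.continuousAt
  rw [funext (Av_eq hp hF hc)]
  exact (((h (x + c)).comp_add_const x c).sub (h x)).const_mul _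

lemma fwdDiff_mem {p : ℝ} (hp : 1 ≤ p) {F : ℝ → ℝ} (hF : MemLpT p F) (c : ℝ) :
    MemLpT p (fwdDiff c F) :=
  (hF.shift hp c).sub hp hF

lemma fwdDiff_iter_mem {p : ℝ} (hp : 1 ≤ p) (c : ℝ) (k : ℕ) {F : ℝ → ℝ} (hF : MemLpT p F) :
    MemLpT p ((fwdDiff c)^[k] F) := by
  induction k with
  | zero => simpa using hF
  | succ k ih =>
    rw [Function.iterate_succ_apply']
    exact fwdDiff_mem hp ih c

lemma Av_iter_mem {p : ℝ} (hp : 1 ≤ p) (c : ℝ) (k : ℕ) {F : ℝ → ℝ} (hF : MemLpT p F) :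
    MemLpT p ((Av c)^[k] F) := by
  induction k with
  | zero => simpa using hF
  | succ k ih =>
    rw [Function.iterate_succ_apply']
    exact (Av_mem hp ih c).1

lemma Av_fwdDiff {p : ℝ} (hp : 1 ≤ p) (c : ℝ) {F : ℝ → ℝ} (hF : MemLpT p F) :
    Av c (fwdDiff c F) = fwdDiff c (Av c F) := by
  ext x
  unfold Av fwdDiff
  rw [intervalIntegral.integral_sub]
  · congr 2
    ext t
    congr 1
    ring
  · have := (hF.shift hp c).comp_affine_intervalIntegrable hp x c 0 1
    exact this
  · exact hF.comp_affine_intervalIntegrable hp x c 0 1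

lemma Av_iter_fwdDiff {p : ℝ} (hp : 1 ≤ p) (c : ℝ) (k : ℕ) {F : ℝ → ℝ} (hF : MemLpT p F) :
    (Av c)^[k] (fwdDiff c F) = fwdDiff c ((Av c)^[k] F) := by
  induction k with
  | zero => rfl
  | succ k ih =>
    rw [Function.iterate_succ_apply', Function.iterate_succ_apply', ih,
      Av_fwdDiff hp c (Av_iter_mem hp c k hF)]

lemma Av_fwdDiff_iter {p : ℝ} (hp : 1 ≤ p) (c : ℝ) (k : ℕ) {F : ℝ → ℝ} (hF : MemLpT p F) :
    Av c ((fwdDiff c)^[k] F) = (fwdDiff c)^[k] (Av c F) := by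
  induction k with
  | zero => rfl
  | succ k ih =>
    rw [Function.iterate_succ_apply', Function.iterate_succ_apply',
      Av_fwdDiff hp c (fwdDiff_iter_mem hp c k hF), ih]

lemma Av_iter_smooth {p : ℝ} (hp : 1 ≤ p) {c : ℝ} (hc : c ≠ 0) (k : ℕ) :
    ∀ F : ℝ → ℝ, MemLpT p F → ContDiff ℝ k ((Av c)^[k + 1] F) ∧
      iteratedDeriv k ((Av c)^[k + 1] F) = fun x => (c⁻¹) ^ k * Av c ((fwdDiff c)^[k] F) x := by
  induction k with
  | zero =>
    intro F hF
    refine ⟨?_, ?_⟩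
    · exact contDiff_zero.2 (Av_continuous hp hF hc)
    · ext x; simp
  | succ k ih =>
    intro F hF
    have hmem := Av_iter_mem hp c (k + 1) hF
    have hcont : Continuous ((Av c)^[k + 1] F) := (ih F hF).1.continuous
    have hd : ∀ x, HasDerivAt ((Av c)^[k + 1 + 1] F)
        (c⁻¹ * (Av c)^[k + 1] (fwdDiff c F) x) x := by
      intro x
      rw [Function.iterate_succ_apply' _ (k + 1), Av_iter_fwdDiff hp c (k + 1) hF]
      exact Av_hasDerivAt hp hmem hcont hc x
    have hderiv : deriv ((Av c)^[k + 1 + 1] F) =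
        fun x => c⁻¹ * (Av c)^[k + 1] (fwdDiff c F) x := funext fun x => (hd x).deriv
    obtain ⟨h1, h2⟩ := ih (fwdDiff c F) (fwdDiff_mem hp hF c)
    constructor
    · push_cast
      rw [contDiff_succ_iff_deriv]
      refine ⟨fun x => (hd x).differentiableAt, by simp, ?_⟩
      rw [hderiv]
      exact contDiff_const.mul h1
    · rw [iteratedDeriv_succ', hderiv]
      ext x
      rw [iteratedDeriv_const_mul_field, h2, pow_succ, Function.iterate_succ_apply]
      ring

/-! ### Differences -/

lemma Delta_eq_fwdDiff (k : ℕ) (h : ℝ) (f : ℝ → ℝ) : Delta k h f = (fwdDiff h)^[k] f := by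
  ext x
  rw [fwdDiff_iter_eq_sum_shift, Delta, ← Finset.sum_range_reflect]
  apply Finset.sum_congr rfl
  intro j hj
  have hj' : j ≤ k := by simpa [Nat.lt_succ_iff] using hj
  have e : k + 1 - 1 - j = k - j := by omega
  rw [e, Nat.choose_symm hj', Nat.cast_sub hj']
  simp

lemma sum_eq_Delta (k : ℕ) (h : ℝ) (f : ℝ → ℝ) (x : ℝ) :
    ∑ j ∈ Finset.range (k + 1), ((-1 : ℝ) ^ j * (k.choose j : ℝ)) * f (x + j * h) =
      (-1) ^ k * Delta k h f x := by
  rw [Delta, ← Finset.sum_range_reflect, Finset.mul_sum]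
  apply Finset.sum_congr rfl
  intro j hj
  have hj' : j ≤ k := by simpa [Nat.lt_succ_iff] using hj
  have e : k + 1 - 1 - j = k - j := by omega
  rw [e, Nat.choose_symm hj', Nat.cast_sub hj']
  have : (-1 : ℝ) ^ (k - j) = (-1) ^ k * (-1) ^ j := by
    have h1 : (-1 : ℝ) ^ k = (-1) ^ (k - j) * (-1) ^ j := by rw [← pow_add]; congr 1; omega
    rw [h1, mul_assoc, ← mul_pow]; simp
  rw [this]
  ring

lemma Delta_mem {p : ℝ} (hp : 1 ≤ p) (k : ℕ) (c : ℝ) {F : ℝ → ℝ} (hF : MemLpT p F) :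
    MemLpT p (Delta k c F) := by
  rw [Delta_eq_fwdDiff]
  exact fwdDiff_iter_mem hp c k hF

lemma fwdDiff_iter_norm_le {p : ℝ} (hp : 1 ≤ p) (c : ℝ) (k : ℕ) {F : ℝ → ℝ} (hF : MemLpT p F) :
    LpNorm p ((fwdDiff c)^[k] F) ≤ 2 ^ k * LpNorm p F := by
  induction k with
  | zero => simp
  | succ k ih =>
    rw [Function.iterate_succ_apply']
    have hm := fwdDiff_iter_mem hp c k hF
    have h := LpNorm_sub_le hp (hm.shift hp c) hm
    rw [LpNorm_shift p hm.1] at h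
    refine h.trans ?_
    rw [pow_succ]
    linarith

lemma le_omegaMod {p : ℝ} (hp : 1 ≤ p) (k : ℕ) {F : ℝ → ℝ} (hF : MemLpT p F) {h δ : ℝ}
    (h0 : 0 < h) (h1 : h < δ) : LpNorm p (Delta k h F) ≤ omegaMod k p F δ := by
  apply le_csSup
  · refine ⟨2 ^ k * LpNorm p F, ?_⟩
    rintro y ⟨h, -, -, rfl⟩
    rw [Delta_eq_fwdDiff]
    exact fwdDiff_iter_norm_le hp h k hF
  · exact ⟨h, h0, h1, rfl⟩

lemma omegaMod_nonneg (k : ℕ) (p : ℝ) (F : ℝ → ℝ) (δ : ℝ) : 0 ≤ omegaMod k p F δ := by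
  apply Real.sSup_nonneg
  rintro y ⟨h, -, -, rfl⟩
  exact LpNorm_nonneg _ _

/-! ### The smooth approximant -/

lemma approx_aux {p : ℝ} (hp : 1 ≤ p) (s : ℕ) {f : ℝ → ℝ} (hf : MemLpT p f) {h U M : ℝ}
    (h0 : 0 < h) (hM : 0 ≤ M)
    (hle : ∀ u, 0 ≤ u → u ≤ U → LpNorm p (fun x =>
      ∑ j ∈ Finset.range (s + 1), ((-1 : ℝ) ^ j * (s.choose j : ℝ)) * f (x + j * u)) ≤ M) (k : ℕ) :
    ∀ u, 0 ≤ u → u + k * h ≤ U → LpNorm p (fun x =>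
      ∑ j ∈ Finset.range (s + 1), ((-1 : ℝ) ^ j * (s.choose j : ℝ)) *
        (Av (j * h))^[k] f (x + j * u)) ≤ M := by
  induction k with
  | zero =>
    intro u hu hU
    exact hle u hu (by simpa using hU)
  | succ k ih =>
    intro u hu hU
    push_cast at hU
    have hm : ∀ j : ℕ, MemLpT p ((Av (j * h))^[k] f) := fun j => Av_iter_mem hp _ k hf
    have e : (fun x => ∑ j ∈ Finset.range (s + 1), ((-1 : ℝ) ^ j * (s.choose j : ℝ)) *
        (Av (j * h))^[k + 1] f (x + j * u)) = fun x => ∫ t in (0:ℝ)..1,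
        ∑ j ∈ Finset.range (s + 1), ((-1 : ℝ) ^ j * (s.choose j : ℝ)) *
        (Av (j * h))^[k] f (x + j * (u + h * t)) := by
      ext x
      rw [intervalIntegral.integral_finsetSum]
      · apply Finset.sum_congr rfl
        intro j _
        rw [intervalIntegral.integral_const_mul, Function.iterate_succ_apply', Av]
        congr 2
        ext t
        ring_nf
      · intro j _
        apply IntervalIntegrable.const_mul
        have := (hm j).comp_affine_intervalIntegrable hp (x + j * u) (j * h) 0 1
        convert this using 3
        ring
    rw [e]
    refine (minkowski hp (fun x t => ∑ j ∈ Finset.range (s + 1),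
      ((-1 : ℝ) ^ j * (s.choose j : ℝ)) * (Av (j * h))^[k] f (x + j * (u + h * t))) ?_ ?_ M hM ?_).2
    · apply Finset.measurable_fun_sum
      intro j _
      exact ((hm j).2.1.comp (by fun_prop)).const_mul _
    · intro t _
      exact MemLpT.sum hp _ _ fun j _ => ((hm j).shift hp _).const_mul hp _
    · intro t ht
      apply ih
      · have := mul_nonneg h0.le ht.1
        linarith
      · have := mul_le_mul_of_nonneg_left ht.2 h0.le
        linarith

noncomputable def gApp (s : ℕ) (h : ℝ) (f : ℝ → ℝ) (x : ℝ) : ℝ :=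
  ∑ j ∈ Finset.range s, ((-1 : ℝ) ^ j * (s.choose (j + 1) : ℝ)) *
    (Av ((j + 1 : ℕ) * h))^[s + 1] f x

lemma gApp_smooth {p : ℝ} (hp : 1 ≤ p) (s : ℕ) {f : ℝ → ℝ} (hf : MemLpT p f) {h : ℝ}
    (h0 : 0 < h) : SobolevW s (gApp s h f) := by
  constructor
  · exact (MemLpT.sum hp _ _ fun j _ => ((Av_iter_mem hp _ (s + 1) hf).const_mul hp _)).1
  · unfold gApp
    apply ContDiff.sum
    intro j _
    apply contDiff_const.mul
    exact (Av_iter_smooth hp (by positivity) s f hf).1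

lemma gApp_deriv {p : ℝ} (hp : 1 ≤ p) (s : ℕ) {f : ℝ → ℝ} (hf : MemLpT p f) {h δ : ℝ}
    (h0 : 0 < h) (hδ : s * h < δ) :
    LpNorm p (iteratedDeriv s (gApp s h f)) ≤
      (s * 2 ^ s) * (h⁻¹) ^ s * omegaMod s p f δ := by
  have hs : ∀ j : ℕ, ((j + 1 : ℕ) * h) ≠ 0 := fun j => by positivity
  have e : iteratedDeriv s (gApp s h f) = fun x => ∑ j ∈ Finset.range s,
      ((-1 : ℝ) ^ j * (s.choose (j + 1) : ℝ) * (((j + 1 : ℕ) * h)⁻¹) ^ s) *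
        Av ((j + 1 : ℕ) * h) ((fwdDiff ((j + 1 : ℕ) * h))^[s] f) x := by
    ext x
    unfold gApp
    rw [iteratedDeriv_fun_sum]
    · apply Finset.sum_congr rfl
      intro j _
      rw [iteratedDeriv_const_mul_field, (Av_iter_smooth hp (hs j) s f hf).2]
      ring
    · intro j _
      exact (contDiff_const.mul (Av_iter_smooth hp (hs j) s f hf).1).contDiffAt
  rw [e]
  have hm : ∀ j : ℕ, MemLpT p ((fwdDiff ((j + 1 : ℕ) * h))^[s] f) := fun j =>
    fwdDiff_iter_mem hp _ s hf
  refine (LpNorm_sum_le hp _ _ fun j _ => ((Av_mem hp (hm j) _).1.const_mul hp _)).trans ?_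
  have hb : ∀ j ∈ Finset.range s, LpNorm p (fun x =>
      ((-1 : ℝ) ^ j * (s.choose (j + 1) : ℝ) * (((j + 1 : ℕ) * h)⁻¹) ^ s) *
        Av ((j + 1 : ℕ) * h) ((fwdDiff ((j + 1 : ℕ) * h))^[s] f) x) ≤
        2 ^ s * (h⁻¹) ^ s * omegaMod s p f δ := by
    intro j hj
    rw [LpNorm_const_mul hp (Av_mem hp (hm j) _).1]
    have h1 : LpNorm p (Av ((j + 1 : ℕ) * h) ((fwdDiff ((j + 1 : ℕ) * h))^[s] f)) ≤
        omegaMod s p f δ := by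
      refine (Av_mem hp (hm j) _).2.trans ?_
      rw [← Delta_eq_fwdDiff]
      apply le_omegaMod hp s hf (by positivity)
      refine lt_of_le_of_lt ?_ hδ
      gcongr
      have := Finset.mem_range.1 hj
      omega
    have h2 : |(-1 : ℝ) ^ j * (s.choose (j + 1) : ℝ) * (((j + 1 : ℕ) * h)⁻¹) ^ s| ≤
        2 ^ s * (h⁻¹) ^ s := by
      rw [abs_mul, abs_mul, abs_pow, abs_neg, abs_one, one_pow, one_mul,
        abs_of_nonneg (by positivity), abs_of_nonneg (by positivity)]
      gcongr
      · exact_mod_cast Nat.choose_le_two_pow s (j + 1)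
      · apply le_mul_of_one_le_left h0.le
        push_cast
        linarith [(Nat.cast_nonneg j : (0:ℝ) ≤ j)]
    exact mul_le_mul h2 h1 (LpNorm_nonneg _ _) (by positivity)
  refine (Finset.sum_le_sum hb).trans ?_
  simp only [Finset.sum_const, Finset.card_range, nsmul_eq_mul]
  apply le_of_eq
  ring

lemma gApp_approx {p : ℝ} (hp : 1 ≤ p) (s : ℕ) (hs : 1 ≤ s) {f : ℝ → ℝ} (hf : MemLpT p f)
    {h δ : ℝ} (h0 : 0 < h) (hδ : (s + 1) * h < δ) :
    LpNorm p (fun x => f x - gApp s h f x) ≤ omegaMod s p f δ := by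
  have h1 := approx_aux hp s hf (U := (s + 1) * h) h0 (omegaMod_nonneg s p f δ) ?_ (s + 1) 0 le_rfl
    (by push_cast; linarith)
  · convert h1 using 2
    ext x
    rw [Finset.sum_range_succ']
    simp only [CharP.cast_eq_zero, zero_mul, mul_zero, add_zero, pow_zero, Nat.choose_zero_right,
      Nat.cast_one, one_mul, mul_one]
    have : (Av 0)^[s + 1] f = f := Function.iterate_fixed (Av_zero f) _
    rw [this, gApp, sub_eq_add_neg, add_comm, ← Finset.sum_neg_distrib]
    congr 1
    apply Finset.sum_congr rfl
    intro j _
    rw [pow_succ]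
    ring
  · intro u hu hU
    simp_rw [sum_eq_Delta]
    rw [LpNorm_const_mul hp (Delta_mem hp s u hf)]
    simp only [abs_pow, abs_neg, abs_one, one_pow, one_mul]
    rcases hu.eq_or_lt with rfl | hu
    · have : Delta s 0 f = fun _ => 0 := by
        obtain ⟨k, rfl⟩ := Nat.exists_eq_add_of_le' hs
        rw [Delta_eq_fwdDiff, Function.iterate_succ_apply']
        ext x
        simp [fwdDiff]
      rw [this, LpNorm_zero hp]
      exact omegaMod_nonneg _ _ _ _
    · exact le_omegaMod hp s hf hu (hU.trans_lt hδ)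

/-! ### Taylor expansion with an integral bound of the remainder -/

lemma taylor_bound (x η : ℝ) (hη : 0 < η) (m : ℕ) :
    ∀ g : ℝ → ℝ, ContDiff ℝ (m + 1 : ℕ) g → ∃ a : ℕ → ℝ, ∀ y, |y - x| ≤ η →
      |g y - ∑ k ∈ Finset.range (m + 1), a k * (y - x) ^ k| ≤
        η ^ m * ∫ u in (x - η)..(x + η), |iteratedDeriv (m + 1) g u| := by
  induction m with
  | zero =>
    intro g hg
    refine ⟨fun _ => g x, fun y hy => ?_⟩
    have hd : Differentiable ℝ g := hg.differentiable (by simp)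
    have hc : Continuous (deriv g) := hg.continuous_deriv (by simp)
    have h1 : ∫ u in x..y, deriv g u = g y - g x :=
      intervalIntegral.integral_deriv_eq_sub (fun u _ => hd u) (hc.intervalIntegrable _ _)
    simp only [zero_add, Finset.range_one, Finset.sum_singleton, pow_zero, mul_one, one_mul,
      iteratedDeriv_one]
    rw [← h1]
    have hy' := abs_le.1 hy
    have h2 := intervalIntegral.norm_integral_le_abs_integral_norm (f := deriv g) (a := x) (b := y)
      (μ := volume)
    rw [Real.norm_eq_abs] at h2
    refine h2.trans ?_
    simp_rw [Real.norm_eq_abs]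
    have h0 : 0 ≤ ∫ u in (x - η)..(x + η), |deriv g u| :=
      intervalIntegral.integral_nonneg (by linarith) fun u _ => abs_nonneg _
    rw [← abs_of_nonneg h0]
    apply intervalIntegral.abs_integral_mono_interval
    · rw [Set.uIoc_of_le (by linarith : x - η ≤ x + η)]
      intro u hu
      rcases Set.mem_uIoc.1 hu with hu | hu
      · exact ⟨by linarith [hu.1], by linarith [hu.2]⟩
      · exact ⟨by linarith [hu.1], by linarith [hu.2]⟩
    · exact Eventually.of_forall fun u => abs_nonneg _
    · exact hc.abs.intervalIntegrable _ _
  | succ m ih =>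
    intro g hg
    have hd : Differentiable ℝ g := hg.differentiable (by simp)
    have hc : Continuous (deriv g) := hg.continuous_deriv (by simp)
    have hdg : ContDiff ℝ (m + 1 : ℕ) (deriv g) := by
      have : ContDiff ℝ ((m + 1 : ℕ) + 1 : WithTop ℕ∞) g := by exact_mod_cast hg
      exact (contDiff_succ_iff_deriv.1 this).2.2
    obtain ⟨b, hb⟩ := ih (deriv g) hdg
    set B := ∫ u in (x - η)..(x + η), |iteratedDeriv (m + 1) (deriv g) u| with hB
    refine ⟨fun k => if k = 0 then g x else b (k - 1) / k, fun y hy => ?_⟩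
    have hq : Continuous fun u : ℝ => ∑ k ∈ Finset.range (m + 1), b k * (u - x) ^ k := by fun_prop
    have h1 : ∫ u in x..y, deriv g u = g y - g x :=
      intervalIntegral.integral_deriv_eq_sub (fun u _ => hd u) (hc.intervalIntegrable _ _)
    have h2 : ∫ u in x..y, ∑ k ∈ Finset.range (m + 1), b k * (u - x) ^ k =
        ∑ k ∈ Finset.range (m + 1), b k / (k + 1) * (y - x) ^ (k + 1) := by
      rw [intervalIntegral.integral_finsetSum
        (fun k _ => (Continuous.intervalIntegrable (by fun_prop) _ _))]
      apply Finset.sum_congr rfl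
      intro k _
      rw [intervalIntegral.integral_const_mul,
        intervalIntegral.integral_comp_sub_right (fun u => u ^ k) x, integral_pow]
      simp
      ring
    have h3 : g y - ∑ k ∈ Finset.range (m + 1 + 1),
        (if k = 0 then g x else b (k - 1) / k) * (y - x) ^ k =
        ∫ u in x..y, (deriv g u - ∑ k ∈ Finset.range (m + 1), b k * (u - x) ^ k) := by
      rw [intervalIntegral.integral_sub (hc.intervalIntegrable _ _) (hq.intervalIntegrable _ _),
        h1, h2, Finset.sum_range_succ']
      simp
      ring
    rw [h3]
    have h4 := intervalIntegral.norm_integral_le_of_norm_le_const (a := x) (b := y)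
      (f := fun u => deriv g u - ∑ k ∈ Finset.range (m + 1), b k * (u - x) ^ k)
      (C := η ^ m * B) (fun u hu => by
        rw [Real.norm_eq_abs]
        apply hb
        have h5 := Set.abs_sub_left_of_mem_uIcc (Set.uIoc_subset_uIcc hu)
        exact h5.trans hy)
    rw [Real.norm_eq_abs] at h4
    have hB0 : 0 ≤ B := intervalIntegral.integral_nonneg (by linarith) fun u _ => abs_nonneg _
    rw [iteratedDeriv_succ', ← hB, pow_succ]
    calc _ ≤ _ := h4
      _ ≤ η ^ m * B * η := by gcongr
      _ = _ := by ring

/-! ### The Steklov operator -/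

lemma steklov_eq {p : ℝ} (hp : 1 ≤ p) {F : ℝ → ℝ} (hF : MemLpT p F) (r : ℕ) (δ x : ℝ) :
    steklov r δ F x = (-1 : ℝ) ^ (r + 1) * (((2 * r).choose r : ℝ))⁻¹ * (2 / δ) *
      ∑ ν ∈ Finset.range r, (-1 : ℝ) ^ ν * (((2 * r).choose ν : ℝ)) *
        ∫ t in (-(δ / 2))..(δ / 2), F (x + (((r : ℝ) - (ν : ℝ)) / (r : ℝ)) * t) := by
  unfold steklov
  rw [intervalIntegral.integral_finsetSum]
  · simp_rw [intervalIntegral.integral_const_mul]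
  · intro ν _
    exact (hF.comp_affine_intervalIntegrable hp _ _ _ _).const_mul _

lemma steklov_sub {p : ℝ} (hp : 1 ≤ p) {F H : ℝ → ℝ} (hF : MemLpT p F) (hH : MemLpT p H)
    (r : ℕ) (δ x : ℝ) :
    steklov r δ (fun y => F y - H y) x = steklov r δ F x - steklov r δ H x := by
  rw [steklov_eq hp hF, steklov_eq hp hH, steklov_eq hp (hF.sub hp hH), ← mul_sub,
    ← Finset.sum_sub_distrib]
  congr 1
  apply Finset.sum_congr rfl
  intro ν _
  rw [intervalIntegral.integral_sub (hF.comp_affine_intervalIntegrable hp _ _ _ _)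
    (hH.comp_affine_intervalIntegrable hp _ _ _ _), mul_sub]

lemma integral_symm_eq_Av (F : ℝ → ℝ) (a δ x : ℝ) (hδ : 0 < δ) :
    ∫ t in (-(δ / 2))..(δ / 2), F (x + a * t) = δ * Av (a * δ) F (x + (-(a * δ / 2))) := by
  unfold Av
  have h := intervalIntegral.mul_integral_comp_add_mul (f := fun t => F (x + a * t)) (a := 0) (b := 1)
    (c := δ) (d := -(δ / 2))
  have e : -(δ / 2) + δ * 1 = δ / 2 := by ring
  rw [e, mul_zero, add_zero] at h
  rw [← h]
  congr 2
  ext t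
  congr 1
  ring

lemma steklov_mem {p : ℝ} (hp : 1 ≤ p) {F : ℝ → ℝ} (hF : MemLpT p F) (r : ℕ) {δ : ℝ}
    (hδ : 0 < δ) : MemLpT p (steklov r δ F) := by
  have e : steklov r δ F = fun x => (-1 : ℝ) ^ (r + 1) * (((2 * r).choose r : ℝ))⁻¹ * (2 / δ) *
      ∑ ν ∈ Finset.range r, (-1 : ℝ) ^ ν * (((2 * r).choose ν : ℝ)) *
        (δ * Av ((((r : ℝ) - (ν : ℝ)) / (r : ℝ)) * δ) F
          (x + (-((((r : ℝ) - (ν : ℝ)) / (r : ℝ)) * δ / 2)))) := by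
    ext x
    rw [steklov_eq hp hF]
    simp_rw [integral_symm_eq_Av F _ δ x hδ]
  rw [e]
  apply MemLpT.const_mul hp
  apply MemLpT.sum hp
  intro ν _
  apply MemLpT.const_mul hp
  apply MemLpT.const_mul hp
  exact (Av_mem hp hF _).1.shift hp _

lemma choose_bound (r ν : ℕ) : (((2 * r).choose ν : ℕ) : ℝ) ≤ 4 ^ r := by
  have h : (2 * r).choose ν ≤ 2 ^ (2 * r) := Nat.choose_le_two_pow _ _
  rw [pow_mul] at h
  exact_mod_cast h

lemma inv_choose_le (r : ℕ) : (((2 * r).choose r : ℕ) : ℝ)⁻¹ ≤ 1 := by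
  apply inv_le_one_of_one_le₀
  exact_mod_cast Nat.choose_pos (by omega)

lemma steklov_bound {p : ℝ} (hp : 1 ≤ p) {F : ℝ → ℝ} (hF : MemLpT p F) (r : ℕ) {δ : ℝ}
    (hδ : 0 < δ) (x : ℝ) : |steklov r δ F x| ≤
      (2 * r ^ 2 * 4 ^ r) * δ⁻¹ * ∫ y in (x - δ / 2)..(x + δ / 2), |F y| := by
  set I := ∫ y in (x - δ / 2)..(x + δ / 2), |F y| with hI
  have hI0 : 0 ≤ I := intervalIntegral.integral_nonneg (by linarith) fun u _ => abs_nonneg _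
  rw [steklov_eq hp hF, abs_mul]
  have hterm : ∀ ν ∈ Finset.range r, |(-1 : ℝ) ^ ν * (((2 * r).choose ν : ℝ)) *
        ∫ t in (-(δ / 2))..(δ / 2), F (x + (((r : ℝ) - (ν : ℝ)) / (r : ℝ)) * t)| ≤
        4 ^ r * (r * I) := by
    intro ν hν
    have hν' : (ν : ℝ) + 1 ≤ r := by exact_mod_cast Finset.mem_range.1 hν
    have hν0 : (0:ℝ) ≤ ν := Nat.cast_nonneg _
    have hr : (0:ℝ) < r := by linarith
    set a := ((r : ℝ) - (ν : ℝ)) / (r : ℝ) with ha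
    have ha0 : 0 < a := div_pos (by linarith) hr
    have ha1 : a ≤ 1 := by rw [ha, div_le_one hr]; linarith
    have har : a⁻¹ ≤ r := by
      rw [ha, inv_div, div_le_iff₀ (by linarith)]
      nlinarith
    rw [abs_mul, abs_mul, abs_pow, abs_neg, abs_one, one_pow, one_mul, Nat.abs_cast]
    refine mul_le_mul (choose_bound r ν) ?_ (abs_nonneg _) (by positivity)
    rw [← Real.norm_eq_abs]
    refine (intervalIntegral.norm_integral_le_integral_norm (by linarith)).trans ?_
    simp_rw [Real.norm_eq_abs]
    rw [intervalIntegral.integral_comp_add_mul (fun y => |F y|) ha0.ne' x, smul_eq_mul]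
    refine mul_le_mul har ?_ ?_ hr.le
    · apply intervalIntegral.integral_mono_interval
      · nlinarith
      · nlinarith
      · nlinarith
      · exact Eventually.of_forall fun u => abs_nonneg _
      · exact hF.abs.intervalIntegrable hp _ _
    · exact intervalIntegral.integral_nonneg (by nlinarith) fun u _ => abs_nonneg _
  have hsum := (Finset.abs_sum_le_sum_abs (fun ν : ℕ => (-1 : ℝ) ^ ν * (((2 * r).choose ν : ℝ)) *
        ∫ t in (-(δ / 2))..(δ / 2), F (x + (((r : ℝ) - (ν : ℝ)) / (r : ℝ)) * t))
        (Finset.range r)).trans (Finset.sum_le_sum hterm)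
  simp only [Finset.sum_const, Finset.card_range, nsmul_eq_mul] at hsum
  have hc : |(-1 : ℝ) ^ (r + 1) * (((2 * r).choose r : ℝ))⁻¹ * (2 / δ)| ≤ 2 * δ⁻¹ := by
    rw [abs_mul, abs_mul, abs_pow, abs_neg, abs_one, one_pow, one_mul, abs_inv, Nat.abs_cast,
      abs_of_pos (by positivity : 0 < 2 / δ), div_eq_mul_inv]
    exact mul_le_of_le_one_left (by positivity) (inv_choose_le r)
  refine (mul_le_mul hc hsum (abs_nonneg _) (by positivity)).trans (le_of_eq ?_)
  ring

lemma poly_kill (r k : ℕ) (hk : k < 2 * r) (hr : 1 ≤ r) (t : ℝ) :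
    ∑ ν ∈ Finset.range (2 * r + 1), (-1 : ℝ) ^ ν * (((2 * r).choose ν : ℝ)) *
      ((((r : ℝ) - (ν : ℝ)) / (r : ℝ)) * t) ^ k = 0 := by
  have h := congrFun (fwdDiff_iter_pow_eq_zero_of_lt (R := ℝ) hk) (-(r : ℝ))
  rw [← Delta_eq_fwdDiff, Delta] at h
  have h2 := congrArg (fun z => z * (t / r) ^ k) h
  simp only [Pi.zero_apply, zero_mul, Finset.sum_mul] at h2
  rw [← h2]
  apply Finset.sum_congr rfl
  intro ν _
  rw [mul_assoc ((-1 : ℝ) ^ ν * _), ← mul_pow]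
  congr 2
  push_cast
  ring

lemma steklov_sub_self {p : ℝ} (hp : 1 ≤ p) {g : ℝ → ℝ} (hg : MemLpT p g) (r : ℕ) (hr : 1 ≤ r)
    {δ : ℝ} (hδ : 0 < δ) (x : ℝ) :
    steklov r δ g x - g x = (-1 : ℝ) ^ (r + 1) * (((2 * r).choose r : ℝ))⁻¹ * δ⁻¹ *
      ∫ t in (-(δ / 2))..(δ / 2), ∑ ν ∈ Finset.range (2 * r + 1),
        (-1 : ℝ) ^ ν * (((2 * r).choose ν : ℝ)) * g (x + (((r : ℝ) - (ν : ℝ)) / (r : ℝ)) * t) := by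
  rw [steklov_eq hp hg, intervalIntegral.integral_finsetSum
    (fun ν _ => (hg.comp_affine_intervalIntegrable hp _ _ _ _).const_mul _)]
  simp_rw [intervalIntegral.integral_const_mul]
  have hr0 : (r : ℝ) ≠ 0 := by positivity
  set J : ℕ → ℝ := fun ν => ∫ t in (-(δ / 2))..(δ / 2), g (x + (((r : ℝ) - (ν : ℝ)) / (r : ℝ)) * t)
    with hJ
  have hJr : J r = δ * g x := by
    simp [hJ]
  have hJs : ∀ j : ℕ, j < r → J (r + (r - 1 - j + 1)) = J j := by
    intro j hj
    simp only [hJ]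
    have h := intervalIntegral.integral_comp_neg (a := -(δ / 2)) (b := δ / 2)
      (fun t => g (x + (((r : ℝ) - (j : ℝ)) / (r : ℝ)) * t))
    rw [neg_neg] at h
    rw [← h]
    congr 1
    ext t
    congr 1
    have e : r - 1 - j + 1 = r - j := by omega
    rw [e, Nat.cast_add, Nat.cast_sub hj.le]
    ring
  have hsplit : ∑ ν ∈ Finset.range (2 * r + 1), (-1 : ℝ) ^ ν * (((2 * r).choose ν : ℝ)) * J ν =
      2 * ∑ ν ∈ Finset.range r, (-1 : ℝ) ^ ν * (((2 * r).choose ν : ℝ)) * J ν +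
        (-1) ^ r * (((2 * r).choose r : ℝ)) * J r := by
    have e : 2 * r + 1 = r + (r + 1) := by omega
    rw [e, Finset.sum_range_add, Finset.sum_range_succ']
    rw [← Finset.sum_range_reflect (fun k => (-1 : ℝ) ^ (r + (k + 1)) *
      (((2 * r).choose (r + (k + 1)) : ℝ)) * J (r + (k + 1)))]
    have : ∀ j ∈ Finset.range r, (-1 : ℝ) ^ (r + (r - 1 - j + 1)) *
        (((2 * r).choose (r + (r - 1 - j + 1)) : ℝ)) * J (r + (r - 1 - j + 1)) =
        (-1 : ℝ) ^ j * (((2 * r).choose j : ℝ)) * J j := by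
      intro j hj
      have hj' := Finset.mem_range.1 hj
      rw [hJs j hj']
      have e1 : r + (r - 1 - j + 1) = 2 * r - j := by omega
      rw [e1, Nat.choose_symm (by omega)]
      congr 2
      have h1 : (-1 : ℝ) ^ (2 * r - j) * (-1) ^ j = 1 := by
        rw [← pow_add, Nat.sub_add_cancel (by omega), pow_mul]; simp
      have h2 : (-1 : ℝ) ^ j * (-1) ^ j = 1 := by rw [← mul_pow]; simp
      calc (-1 : ℝ) ^ (2 * r - j) = (-1 : ℝ) ^ (2 * r - j) * ((-1) ^ j * (-1) ^ j) := by
            rw [h2, mul_one]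
        _ = _ := by rw [← mul_assoc, h1, one_mul]
    rw [Finset.sum_congr rfl this, add_zero]
    ring
  rw [hsplit, hJr]
  have hch : (((2 * r).choose r : ℕ) : ℝ) ≠ 0 := by
    have := Nat.choose_pos (show r ≤ 2 * r by omega)
    positivity
  have hsg : (-1 : ℝ) ^ r * (-1) ^ r = 1 := by rw [← mul_pow]; simp
  have : (-1 : ℝ) ^ (r + 1) * (((2 * r).choose r : ℝ))⁻¹ * δ⁻¹ *
      ((-1) ^ r * (((2 * r).choose r : ℝ)) * (δ * g x)) = - g x := by
    rw [pow_succ]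
    field_simp
    linear_combination (-(g x)) * hsg
  rw [mul_add, this]
  ring

lemma steklov_smooth_bound {p : ℝ} (hp : 1 ≤ p) {g : ℝ → ℝ} (hg : MemLpT p g) (r s : ℕ)
    (hr : 1 ≤ r) (hs : 1 ≤ s) (hsr : s ≤ 2 * r) (hsm : ContDiff ℝ (s : ℕ) g)
    {δ : ℝ} (hδ : 0 < δ) (x : ℝ) :
    |steklov r δ g x - g x| ≤ ((2 * r + 1) * 4 ^ r) * δ ^ (s - 1) *
      ∫ y in (x - δ / 2)..(x + δ / 2), |iteratedDeriv s g y| := by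
  obtain ⟨m, rfl⟩ := Nat.exists_eq_add_of_le' hs
  obtain ⟨a, ha⟩ := taylor_bound x (δ / 2) (by linarith) m g hsm
  set I := ∫ y in (x - δ / 2)..(x + δ / 2), |iteratedDeriv (m + 1) g y| with hI
  have hI0 : 0 ≤ I := intervalIntegral.integral_nonneg (by linarith) fun u _ => abs_nonneg _
  have hr0 : (0 : ℝ) < r := by positivity
  rw [steklov_sub_self hp hg r hr hδ]
  have hin : ∀ t ∈ Set.uIoc (-(δ / 2)) (δ / 2), ‖∑ ν ∈ Finset.range (2 * r + 1),
        (-1 : ℝ) ^ ν * (((2 * r).choose ν : ℝ)) * g (x + (((r : ℝ) - (ν : ℝ)) / (r : ℝ)) * t)‖ ≤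
        ((2 * r + 1) * 4 ^ r) * (δ ^ m * I) := by
    intro t ht
    rw [Set.uIoc_of_le (by linarith)] at ht
    have ht' : |t| ≤ δ / 2 := abs_le.2 ⟨ht.1.le, ht.2⟩
    have hz : ∑ ν ∈ Finset.range (2 * r + 1), (-1 : ℝ) ^ ν * (((2 * r).choose ν : ℝ)) *
        ∑ k ∈ Finset.range (m + 1), a k * ((((r : ℝ) - (ν : ℝ)) / (r : ℝ)) * t) ^ k = 0 := by
      simp_rw [Finset.mul_sum]
      rw [Finset.sum_comm]
      apply Finset.sum_eq_zero
      intro k hk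
      have h := poly_kill r k (by have := Finset.mem_range.1 hk; omega) hr t
      have h2 := congrArg (fun z => a k * z) h
      simp only [mul_zero, Finset.mul_sum] at h2
      rw [← h2]
      apply Finset.sum_congr rfl
      intro ν _
      ring
    rw [Real.norm_eq_abs, ← sub_zero (∑ ν ∈ Finset.range (2 * r + 1), _), ← hz,
      ← Finset.sum_sub_distrib]
    refine (Finset.abs_sum_le_sum_abs _ _).trans ?_
    have hb : ∀ ν ∈ Finset.range (2 * r + 1), |(-1 : ℝ) ^ ν * (((2 * r).choose ν : ℝ)) *
        g (x + (((r : ℝ) - (ν : ℝ)) / (r : ℝ)) * t) - (-1 : ℝ) ^ ν * (((2 * r).choose ν : ℝ)) *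
        ∑ k ∈ Finset.range (m + 1), a k * ((((r : ℝ) - (ν : ℝ)) / (r : ℝ)) * t) ^ k| ≤
        4 ^ r * (δ ^ m * I) := by
      intro ν hν
      rw [← mul_sub, abs_mul, abs_mul, abs_pow, abs_neg, abs_one, one_pow, one_mul, Nat.abs_cast]
      refine mul_le_mul (choose_bound r ν) ?_ (abs_nonneg _) (by positivity)
      have hν2 : (ν : ℝ) ≤ 2 * r := by
        have := Finset.mem_range.1 hν
        exact_mod_cast (by omega : ν ≤ 2 * r)
      have hν0 : (0:ℝ) ≤ ν := Nat.cast_nonneg _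
      have h1 : |((r : ℝ) - (ν : ℝ)) / (r : ℝ)| ≤ 1 := by
        rw [abs_div, abs_of_pos hr0, div_le_one hr0, abs_le]
        constructor <;> linarith
      have h2 := ha (x + (((r : ℝ) - (ν : ℝ)) / (r : ℝ)) * t) (by
        rw [add_sub_cancel_left, abs_mul]
        exact (mul_le_of_le_one_left (abs_nonneg _) h1).trans ht')
      rw [add_sub_cancel_left] at h2
      refine h2.trans ?_
      gcongr
      linarith
    refine (Finset.sum_le_sum hb).trans (le_of_eq ?_)
    simp only [Finset.sum_const, Finset.card_range, nsmul_eq_mul]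
    push_cast
    ring
  have hint := intervalIntegral.norm_integral_le_of_norm_le_const hin
  rw [Real.norm_eq_abs] at hint
  have hlen : |δ / 2 - -(δ / 2)| = δ := by
    rw [sub_neg_eq_add, add_halves, abs_of_pos hδ]
  rw [hlen] at hint
  have hc : |(-1 : ℝ) ^ (r + 1) * (((2 * r).choose r : ℝ))⁻¹ * δ⁻¹| ≤ δ⁻¹ := by
    rw [abs_mul, abs_mul, abs_pow, abs_neg, abs_one, one_pow, one_mul, abs_inv, Nat.abs_cast,
      abs_of_pos (inv_pos.2 hδ)]
    exact mul_le_of_le_one_left (by positivity) (inv_choose_le r)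
  rw [abs_mul]
  refine (mul_le_mul hc hint (abs_nonneg _) (by positivity)).trans (le_of_eq ?_)
  rw [Nat.add_sub_cancel]
  field_simp

/-! ### Discretization -/

lemma jensen_interval {p : ℝ} (hp : 1 ≤ p) {H : ℝ → ℝ} (hH : MemLpT p H) (hH0 : ∀ y, 0 ≤ H y)
    (a b : ℝ) (hab : a < b) :
    (∫ y in a..b, H y) ^ p ≤ (b - a) ^ (p - 1) * ∫ y in a..b, |H y| ^ p := by
  have hper : Function.Periodic (fun x => |H x| ^ p) 1 := fun x => by simp [hH.1 x]
  have hi := hper.intervalIntegrable (t := 0) one_ne_zero (by simpa using hH.2.2) a b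
  have hi1 := hH.intervalIntegrable hp a b
  rw [intervalIntegrable_iff_integrableOn_Ioc_of_le hab.le] at hi hi1
  have e : ∀ y, |H y| ^ p = H y ^ p := fun y => by rw [abs_of_nonneg (hH0 y)]
  simp_rw [e] at hi ⊢
  have h := ConvexOn.map_set_average_le (μ := volume) (t := Set.Ioc a b) (f := H)
    (convexOn_rpow hp) (continuousOn_id.rpow_const fun x _ => Or.inr (by linarith)) isClosed_Ici
    (by simp [hab]) (by simp) (Eventually.of_forall hH0) hi1 hi
  rw [setAverage_eq, setAverage_eq, smul_eq_mul, smul_eq_mul] at h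
  simp only [measureReal_def, Real.volume_Ioc, ENNReal.toReal_ofReal (sub_pos.2 hab).le] at h
  rw [← intervalIntegral.integral_of_le hab.le, ← intervalIntegral.integral_of_le hab.le] at h
  have hpos : 0 < b - a := sub_pos.2 hab
  rw [Real.mul_rpow (by positivity)
    (intervalIntegral.integral_nonneg hab.le fun u _ => hH0 u), Real.inv_rpow hpos.le,
    inv_mul_le_iff₀ (by positivity)] at h
  refine h.trans (le_of_eq ?_)
  rw [Real.rpow_sub hpos, Real.rpow_one]
  field_simp

lemma discretize {p γ : ℝ} (hp : 1 ≤ p) (hγ0 : 0 < γ) (hγ1 : γ ≤ 1) {X : ℕ → ℕ → ℝ}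
    (hX : NodesOK γ X) {n : ℕ} (hn : 1 ≤ n) {H D : ℝ → ℝ} (hH : MemLpT p H) (hH0 : ∀ y, 0 ≤ H y)
    (hD : ∀ x, |D x| ≤ ∫ y in (x - γ / n / 2)..(x + γ / n / 2), H y) :
    ellp p n (X n) D ≤ (1 / n) * LpNorm p H := by
  have hn0 : (0 : ℝ) < n := by exact_mod_cast hn
  set δ := γ / n with hδdef
  have hδ : 0 < δ := by positivity
  have hp0 : 0 < p := by linarith
  set W : ℝ → ℝ := fun x => |H x| ^ p with hW
  have hW0 : ∀ x, 0 ≤ W x := fun x => Real.rpow_nonneg (abs_nonneg _) _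
  have hper : Function.Periodic W 1 := fun x => by simp [hW, hH.1 x]
  have hi : ∀ a b, IntervalIntegrable W volume a b :=
    hper.intervalIntegrable (t := 0) one_ne_zero (by simpa using hH.2.2)
  obtain ⟨-, -, -, hgap, hlast⟩ := hX n hn
  have hpack : ∀ m : ℕ, m < n → ∑ k ∈ Finset.range (m + 1),
      ∫ y in (X n k - δ / 2)..(X n k + δ / 2), W y ≤
        ∫ y in (X n 0 - δ / 2)..(X n m + δ / 2), W y := by
    intro m
    induction m with
    | zero => intro _; simp
    | succ m ih =>
      intro hm
      rw [Finset.sum_range_succ]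
      have h1 := ih (by omega)
      have h2 : 0 ≤ ∫ y in (X n m + δ / 2)..(X n (m + 1) - δ / 2), W y :=
        intervalIntegral.integral_nonneg (by linarith [hgap m hm]) fun u _ => hW0 u
      have h3 := intervalIntegral.integral_add_adjacent_intervals
        (hi (X n 0 - δ / 2) (X n m + δ / 2)) (hi (X n m + δ / 2) (X n (m + 1) - δ / 2))
      have h4 := intervalIntegral.integral_add_adjacent_intervals
        (hi (X n 0 - δ / 2) (X n (m + 1) - δ / 2))
        (hi (X n (m + 1) - δ / 2) (X n (m + 1) + δ / 2))
      linarith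
  have htot : ∑ k ∈ Finset.range n, ∫ y in (X n k - δ / 2)..(X n k + δ / 2), W y ≤
      ∫ y in (0:ℝ)..1, W y := by
    have h1 := hpack (n - 1) (by omega)
    rw [Nat.sub_add_cancel hn] at h1
    have h2 := hper.intervalIntegral_add_eq (X n 0 - δ / 2) 0
    rw [zero_add] at h2
    rw [← h2]
    refine h1.trans ?_
    have h3 : 0 ≤ ∫ y in (X n (n - 1) + δ / 2)..(X n 0 - δ / 2 + 1), W y :=
      intervalIntegral.integral_nonneg (by linarith) fun u _ => hW0 u
    have h4 := intervalIntegral.integral_add_adjacent_intervals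
        (hi (X n 0 - δ / 2) (X n (n - 1) + δ / 2)) (hi (X n (n - 1) + δ / 2) (X n 0 - δ / 2 + 1))
    linarith
  set I := ∫ y in (0:ℝ)..1, W y with hI
  have hI0 : 0 ≤ I := intervalIntegral.integral_nonneg zero_le_one fun u _ => hW0 u
  have hpt : ∀ k ∈ Finset.range n, |D (X n k)| ^ p ≤
      δ ^ (p - 1) * ∫ y in (X n k - δ / 2)..(X n k + δ / 2), W y := by
    intro k _
    have h := jensen_interval hp hH hH0 (X n k - δ / 2) (X n k + δ / 2) (by linarith)
    have e : X n k + δ / 2 - (X n k - δ / 2) = δ := by ring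
    rw [e] at h
    exact (Real.rpow_le_rpow (abs_nonneg _) (hD (X n k)) hp0.le).trans h
  have hsum : (1 / (n : ℝ)) * ∑ k ∈ Finset.range n, |D (X n k)| ^ p ≤ (1 / (n : ℝ)) ^ p * I := by
    have h1 : ∑ k ∈ Finset.range n, |D (X n k)| ^ p ≤ δ ^ (p - 1) * I := by
      refine (Finset.sum_le_sum hpt).trans ?_
      rw [← Finset.mul_sum]
      gcongr
    have h2 : δ ^ (p - 1) ≤ (1 / (n : ℝ)) ^ (p - 1) := by
      apply Real.rpow_le_rpow hδ.le _ (by linarith)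
      rw [hδdef]
      gcongr
    have h3 : (1 / (n : ℝ)) ^ p = (1 / (n : ℝ)) * (1 / (n : ℝ)) ^ (p - 1) := by
      rw [Real.rpow_sub (by positivity), Real.rpow_one]
      field_simp
    rw [h3, mul_assoc]
    gcongr
    exact h1.trans (by gcongr)
  unfold ellp LpNorm
  refine (Real.rpow_le_rpow (by positivity) hsum (by positivity)).trans (le_of_eq ?_)
  rw [Real.mul_rpow (by positivity) hI0, ← Real.rpow_mul (by positivity),
    mul_one_div_cancel hp0.ne', Real.rpow_one]

/-! ### Main theorem -/

theorem stmt3 (p γ : ℝ) (r s : ℕ) (X : ℕ → ℕ → ℝ) (φ : ℕ → ℕ → ℝ → ℝ)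
    (G : ℕ → (ℝ → ℝ) → ℝ → ℝ)
    (hp : 1 ≤ p) (hr : 1 ≤ r) (hs : 1 ≤ s) (hsr : s ≤ 2 * r)
    (hγ0 : 0 < γ) (hγ1 : γ ≤ 1) (hX : NodesOK γ X) (hGform : SamplingForm p X φ G)
    (K1 : ℝ) (hK1 : 0 < K1) (hc1 : CondC1 p K1 X G) (K3 : ℝ) (hK3 : 0 < K3) (hc2' : CondC2' p K3 s G) :
    ∃ C1 : ℝ, 0 < C1 ∧ ∀ f : ℝ → ℝ, MemLpT p f → ∀ n : ℕ, 1 ≤ n →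
      LpNorm p (fun x => f x - G n f x) ≤
        K1 * ellp p n (X n) (fun x => steklov r (γ / (n : ℝ)) f x - f x) + C1 * omegaMod s p f (1 / (n : ℝ)) := by
  have hn0 : ∀ {n : ℕ}, 1 ≤ n → (0 : ℝ) < n := fun h => by exact_mod_cast h
  set A : ℝ := (2 * r + 1) * 4 ^ r with hA
  set B : ℝ := 2 * r ^ 2 * 4 ^ r with hB
  set Q : ℝ := s * 2 ^ s * (2 * (s + 1)) ^ s with hQ
  have hA0 : 0 ≤ A := by positivity
  have hB0 : 0 ≤ B := by positivity
  have hQ0 : 0 ≤ Q := by positivity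
  refine ⟨1 + K3 * Q + K1 * (A * Q + B / γ), by positivity, ?_⟩
  intro f hf n hn
  have hnpos := hn0 hn
  set δ := γ / (n : ℝ) with hδdef
  have hδ : 0 < δ := by positivity
  set ω := omegaMod s p f (1 / (n : ℝ)) with hω
  have hω0 : 0 ≤ ω := omegaMod_nonneg _ _ _ _
  set h : ℝ := 1 / (2 * (s + 1) * n) with hh
  have h0 : 0 < h := by positivity
  have hlt : (s + 1) * h < 1 / (n : ℝ) := by
    have : (s + 1) * h = 1 / (n : ℝ) / 2 := by
      rw [hh]; field_simp
    rw [this]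
    exact half_lt_self (by positivity)
  have hlt' : s * h < 1 / (n : ℝ) := by linarith
  set g := gApp s h f with hg
  have hgS : SobolevW s g := gApp_smooth hp s hf h0
  have hgsm : ContDiff ℝ (s : ℕ) g := hgS.2
  have hgm : MemLpT p g := memLpT_of_continuous hp hgsm.continuous hgS.1
  have hfg : LpNorm p (fun x => f x - g x) ≤ ω := gApp_approx hp s hs hf h0 hlt
  have hfgm : MemLpT p (fun x => f x - g x) := hf.sub hp hgm
  have hgfm : MemLpT p (fun x => g x - f x) := hgm.sub hp hf
  have hgf : LpNorm p (fun x => g x - f x) ≤ ω := by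
    refine le_trans (le_of_eq ?_) hfg
    rw [← LpNorm_abs, ← LpNorm_abs p (fun x => f x - g x)]
    simp_rw [abs_sub_comm]
  -- derivative bound
  have hder : (1 / (n : ℝ) ^ s) * LpNorm p (iteratedDeriv s g) ≤ Q * ω := by
    have h1 := gApp_deriv hp s hf h0 hlt'
    calc _ ≤ (1 / (n : ℝ) ^ s) * ((s * 2 ^ s) * (h⁻¹) ^ s * ω) := by gcongr
      _ = Q * ω := by
        rw [hh, one_div, one_div, inv_inv, mul_pow (2 * ((s : ℝ) + 1)) (n : ℝ), hQ]
        field_simp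
  have hdm : MemLpT p (iteratedDeriv s g) := by
    apply memLpT_of_continuous hp (hgsm.continuous_iteratedDeriv' s)
    intro x
    have := iteratedDeriv_comp_add_const s g 1
    have e : (fun z => g (z + 1)) = g := funext hgS.1
    rw [e] at this
    exact (congrFun this x).symm
  -- the sampling operator
  have hGm : ∀ F : ℝ → ℝ, MemLpT p (G n F) := by
    intro F
    rw [funext (hGform.2 n F)]
    exact MemLpT.sum hp _ _ fun k _ => (hGform.1 n k).const_mul hp _
  have hGsub : ∀ F H : ℝ → ℝ, ∀ x, G n (fun y => F y - H y) x = G n F x - G n H x := by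
    intro F H x
    simp_rw [hGform.2, sub_mul, Finset.sum_sub_distrib]
  set S := steklov r δ f with hS
  have hSm : MemLpT p S := steklov_mem hp hf r hδ
  have hgSm : MemLpT p (fun x => g x - S x) := hgm.sub hp hSm
  have hSfm : MemLpT p (fun x => S x - f x) := hSm.sub hp hf
  -- discrete norm of g - S
  have hdisc : ellp p n (X n) (fun x => g x - S x) ≤ (A * Q + B / γ) * ω := by
    have hHm : MemLpT p (fun y => A * δ ^ (s - 1) * |iteratedDeriv s g y| +
        B * δ⁻¹ * |g y - f y|) :=
      (hdm.abs.const_mul hp _).add hp (hgfm.abs.const_mul hp _)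
    have hb := discretize hp hγ0 hγ1 hX hn (D := fun x => g x - S x) hHm
      (fun y => by positivity) ?_
    · have h1 := LpNorm_add_le hp (hdm.abs.const_mul hp (A * δ ^ (s - 1)))
        (hgfm.abs.const_mul hp (B * δ⁻¹))
      rw [LpNorm_const_mul hp hdm.abs, LpNorm_const_mul hp hgfm.abs, LpNorm_abs,
        LpNorm_abs p (fun x => g x - f x), abs_of_nonneg (by positivity),
        abs_of_nonneg (by positivity)] at h1
      have h2 : δ ^ (s - 1) ≤ (1 / (n : ℝ)) ^ (s - 1) := by
        rw [hδdef]
        gcongr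
      have h3 : (1 / (n : ℝ)) * (1 / (n : ℝ)) ^ (s - 1) = 1 / (n : ℝ) ^ s := by
        rw [← pow_succ', Nat.sub_add_cancel hs, one_div_pow]
      have h4 : (1 / (n : ℝ)) * δ⁻¹ = 1 / γ := by
        rw [hδdef]; field_simp
      have hd0 := LpNorm_nonneg p (iteratedDeriv s g)
      calc _ ≤ _ := hb
        _ ≤ (1 / (n : ℝ)) * (A * δ ^ (s - 1) * LpNorm p (iteratedDeriv s g) +
            B * δ⁻¹ * LpNorm p (fun x => g x - f x)) := by gcongr
        _ ≤ (1 / (n : ℝ)) * (A * (1 / (n : ℝ)) ^ (s - 1) * LpNorm p (iteratedDeriv s g) +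
            B * δ⁻¹ * ω) := by gcongr
        _ = A * (((1 / (n : ℝ)) * (1 / (n : ℝ)) ^ (s - 1)) * LpNorm p (iteratedDeriv s g)) +
            B * ((1 / (n : ℝ)) * δ⁻¹) * ω := by ring
        _ = A * ((1 / (n : ℝ) ^ s) * LpNorm p (iteratedDeriv s g)) + B * (1 / γ) * ω := by
            rw [h3, h4]
        _ ≤ A * (Q * ω) + B * (1 / γ) * ω := by gcongr
        _ = _ := by ring
    · intro x
      have e1 : g x - S x = -(steklov r δ g x - g x) + steklov r δ (fun y => g y - f y) x := by
        rw [steklov_sub hp hgm hf]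
        ring
      have b1 := steklov_smooth_bound hp hgm r s hr hs hsr hgsm hδ x
      have b2 := steklov_bound hp hgfm r hδ x
      rw [intervalIntegral.integral_add
        ((hdm.abs.const_mul hp _).intervalIntegrable hp _ _)
        ((hgfm.abs.const_mul hp _).intervalIntegrable hp _ _),
        intervalIntegral.integral_const_mul, intervalIntegral.integral_const_mul, e1]
      refine (abs_add_le _ _).trans ?_
      rw [abs_neg]
      exact add_le_add b1 b2
  -- conclusion
  have t1 : LpNorm p (fun x => g x - G n g x) ≤ K3 * Q * ω := by
    refine (hc2' g hgS n hn).trans ?_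
    calc K3 / (n : ℝ) ^ s * LpNorm p (iteratedDeriv s g)
        = K3 * ((1 / (n : ℝ) ^ s) * LpNorm p (iteratedDeriv s g)) := by ring
      _ ≤ K3 * (Q * ω) := by gcongr
      _ = _ := by ring
  have t2 : LpNorm p (G n (fun x => g x - S x)) ≤ K1 * ((A * Q + B / γ) * ω) :=
    (hc1 _ hgSm n hn).trans (by gcongr)
  have t3 := hc1 _ hSfm n hn
  have e : (fun x => f x - G n f x) = fun x => ((f x - g x) + (g x - G n g x)) +
      (G n (fun x => g x - S x) x + G n (fun x => S x - f x) x) := by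
    ext x
    rw [hGsub, hGsub]
    ring
  have hgG : MemLpT p (fun x => g x - G n g x) := hgm.sub hp (hGm g)
  rw [e]
  have u1 := LpNorm_add_le hp (hfgm.add hp hgG)
    ((hGm (fun x => g x - S x)).add hp (hGm (fun x => S x - f x)))
  have u2 := LpNorm_add_le hp hfgm hgG
  have u3 := LpNorm_add_le hp (hGm (fun x => g x - S x)) (hGm (fun x => S x - f x))
  have u4 : (1 + K3 * Q + K1 * (A * Q + B / γ)) * ω =
    ω + K3 * Q * ω + K1 * ((A * Q + B / γ) * ω) := by ring
  rw [u4]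
  linarith
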